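/- arXiv:1708.09561 — 5 statements merged into one kernel-verified Lean document; each statement's English description precedes it below -/
import Mathlib

section
/- Let J ≥ 1, let a : Fin J → ℝ satisfy a_c > 0 for all c, let W : Fin J → ℝ, and let C ≥ 0. Then there exists a real number G ≥ 0 such that Σ_c a_c·[W_c − G]⁺ ≤ C, and moreover either G = 0 or Σ_c a_c·[W_c − G]⁺ = C. -/
/-- Existence of a waterfilling level: there is a common threshold `G ≥ 0`
such that the weighted total of the clipped surpluses `[W_c − G]⁺` respects
the capacity `C`, with complementary slackness (the capacity constraint is
tight whenever the threshold is strictly positive). -/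
theorem waterfilling_level_exists (J : ℕ) (hJ : 1 ≤ J)
    (a : Fin J → ℝ) (ha : ∀ c, 0 < a c) (W : Fin J → ℝ)
    (C : ℝ) (hC : 0 ≤ C) :
    ∃ G : ℝ, 0 ≤ G ∧ (∑ c, a c * max (W c - G) 0 ≤ C) ∧
      (G = 0 ∨ ∑ c, a c * max (W c - G) 0 = C) := by
  by_cases h : ∑ c, a c * max (W c - 0) 0 ≤ C
  · exact ⟨0, le_rfl, h, Or.inl rfl⟩
  have hcont : Continuous fun G : ℝ => ∑ c, a c * max (W c - G) 0 := by fun_prop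
  have hM : 0 ≤ ∑ c, |W c| := Finset.sum_nonneg fun c _ => abs_nonneg (W c)
  have hzero : ∑ c, a c * max (W c - ∑ d, |W d|) 0 = 0 := by
    refine Finset.sum_eq_zero fun c _ => ?_
    have hle : |W c| ≤ ∑ d, |W d| :=
      Finset.single_le_sum (fun d _ => abs_nonneg (W d)) (Finset.mem_univ c)
    rw [max_eq_right (sub_nonpos.2 ((le_abs_self _).trans hle)), mul_zero]
  obtain ⟨G, hG, hGC⟩ := intermediate_value_Icc' hM hcont.continuousOn
    ⟨hzero.le.trans hC, (not_le.1 h).le⟩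
  exact ⟨G, hG.1, hGC.le, Or.inr hGC⟩
end

section
/- Let J ≥ 1, let W : Fin J → ℝ, let C ≥ 0, and let G ≥ 0 satisfy Σ_c (1/2)·[W_c − G]⁺ ≤ C and (G = 0 or Σ_c (1/2)·[W_c − G]⁺ = C). Define μ*_c = (1/2)·[W_c − G]⁺ for each c. Then for every μ : Fin J → ℝ with μ_c ≥ 0 for all c and Σ_c μ_c ≤ C, we have Σ_c ((μ*_c)² − W_c·μ*_c) ≤ Σ_c ((μ_c)² − W_c·μ_c); that is, μ* is a global minimizer of the quadratic objective Σ_c (μ_c² − W_c μ_c) over the feasible set {μ ≥ 0 : Σ_c μ_c ≤ C}. -/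
/-- The positive part `(1/2)·[w − g]⁺` minimizes the penalized quadratic
`x² − w·x + g·x` over `x ≥ 0`. -/
theorem half_posPart_minimizes_penalized_quadratic (w g x : ℝ) (hx : 0 ≤ x) :
    ((1 / 2) * max (w - g) 0) ^ 2 - w * ((1 / 2) * max (w - g) 0)
        + g * ((1 / 2) * max (w - g) 0) ≤ x ^ 2 - w * x + g * x := by
  rcases le_total (w - g) 0 with h | h
  · rw [max_eq_right h]
    nlinarith [mul_nonneg hx (sub_nonneg.2 h), sq_nonneg x]
  · rw [max_eq_left h]
    nlinarith [sq_nonneg (x - (w - g) / 2)]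

/-- Correctness of the DCNC-Q local transmission decision (KKT waterfilling
solution): `μ*_c = (1/2)·[W_c − G]⁺` globally minimizes the quadratic
objective `∑ (μ_c² − W_c·μ_c)` over `{μ ≥ 0 : ∑ μ_c ≤ C}`. -/
theorem dcnc_q_transmission_optimal (J : ℕ) (hJ : 1 ≤ J)
    (W : Fin J → ℝ) (C : ℝ) (hC : 0 ≤ C)
    (G : ℝ) (hG : 0 ≤ G)
    (hfeas : ∑ c, (1 / 2) * max (W c - G) 0 ≤ C)
    (hslack : G = 0 ∨ ∑ c, (1 / 2) * max (W c - G) 0 = C)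
    (μstar : Fin J → ℝ) (hμstar : ∀ c, μstar c = (1 / 2) * max (W c - G) 0) :
    ∀ μ : Fin J → ℝ, (∀ c, 0 ≤ μ c) → (∑ c, μ c ≤ C) →
      ∑ c, ((μstar c) ^ 2 - W c * μstar c) ≤ ∑ c, ((μ c) ^ 2 - W c * μ c) := by
  intro μ hμ hsum
  obtain rfl : μstar = fun c => (1 / 2) * max (W c - G) 0 := funext hμstar
  have hpen := Finset.sum_le_sum fun c (_ : c ∈ Finset.univ) =>
    half_posPart_minimizes_penalized_quadratic (W c) G (μ c) (hμ c)
  rw [Finset.sum_add_distrib, Finset.sum_add_distrib, ← Finset.mul_sum _ _ G,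
    ← Finset.mul_sum _ _ G] at hpen
  have hprice : G * ∑ c, μ c ≤ G * ∑ c, (1 / 2) * max (W c - G) 0 := by
    rcases hslack with h | h
    · simp [h]
    · rw [h]
      exact mul_le_mul_of_nonneg_left hsum hG
  beta_reduce
  linarith
end

section
/- Let J ≥ 1 and for each c ∈ Fin J let r_c > 0, ξ_c ∈ ℝ, and W_c ∈ ℝ, and let C ≥ 0. Let G ≥ 0 satisfy Σ_c (r_c²/(1 + ξ_c²))·[W_c − G]⁺ ≤ C and (G = 0 or Σ_c (r_c²/(1 + ξ_c²))·[W_c − G]⁺ = C). Define μ*_c = (r_c/(1 + ξ_c²))·[W_c − G]⁺ for each c. Then for every μ : Fin J → ℝ with μ_c ≥ 0 for all c and Σ_c r_c·μ_c ≤ C, we have Σ_c ( ((1 + ξ_c²)/2)·(μ*_c)² − r_c·W_c·μ*_c ) ≤ Σ_c ( ((1 + ξ_c²)/2)·(μ_c)² − r_c·W_c·μ_c ); that is, μ* is a global minimizer of the weighted quadratic objective over the feasible set {μ ≥ 0 : Σ_c r_c μ_c ≤ C}. -/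
/-- The waterfilling level `r / a * [W - G]⁺` minimizes the one-commodity Lagrangian
`a / 2 * x ^ 2 - r * W * x + G * (r * x)` over `x ≥ 0`. -/
theorem waterfilling_lagrangian_le {a r : ℝ} (ha : 0 < a) (hr : 0 ≤ r) (W G : ℝ)
    {x : ℝ} (hx : 0 ≤ x) :
    a / 2 * (r / a * max (W - G) 0) ^ 2 - r * W * (r / a * max (W - G) 0)
        + G * (r * (r / a * max (W - G) 0)) ≤
      a / 2 * x ^ 2 - r * W * x + G * (r * x) := by
  rcases le_total (W - G) 0 with h | h
  · rw [max_eq_right h]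
    have h₁ : 0 ≤ r * x * (G - W) := mul_nonneg (mul_nonneg hr hx) (by linarith)
    have h₂ : 0 ≤ a / 2 * x ^ 2 := by positivity
    linarith
  · rw [max_eq_left h]
    have h₁ : 0 ≤ a / 2 * (x - r / a * (W - G)) ^ 2 := by positivity
    have h₂ : a / 2 * x ^ 2 - r * W * x + G * (r * x)
        - (a / 2 * (r / a * (W - G)) ^ 2 - r * W * (r / a * (W - G))
          + G * (r * (r / a * (W - G)))) = a / 2 * (x - r / a * (W - G)) ^ 2 := by
      field_simp
      ring
    linarith

/-- Correctness of the DCNC-Q local processing decision (KKT waterfilling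
solution): `μ*_c = (r_c/(1+ξ_c²))·[W_c − G]⁺` globally minimizes the weighted
quadratic objective over `{μ ≥ 0 : ∑ r_c μ_c ≤ C}`. -/
theorem dcnc_q_processing_optimal (J : ℕ) (hJ : 1 ≤ J)
    (r ξ W : Fin J → ℝ) (hr : ∀ c, 0 < r c)
    (C : ℝ) (hC : 0 ≤ C)
    (G : ℝ) (hG : 0 ≤ G)
    (hfeas : ∑ c, (r c) ^ 2 / (1 + (ξ c) ^ 2) * max (W c - G) 0 ≤ C)
    (hslack : G = 0 ∨ ∑ c, (r c) ^ 2 / (1 + (ξ c) ^ 2) * max (W c - G) 0 = C)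
    (μstar : Fin J → ℝ)
    (hμstar : ∀ c, μstar c = r c / (1 + (ξ c) ^ 2) * max (W c - G) 0) :
    ∀ μ : Fin J → ℝ, (∀ c, 0 ≤ μ c) → (∑ c, r c * μ c ≤ C) →
      ∑ c, ((1 + (ξ c) ^ 2) / 2 * (μstar c) ^ 2 - r c * W c * μstar c) ≤
        ∑ c, ((1 + (ξ c) ^ 2) / 2 * (μ c) ^ 2 - r c * W c * μ c) := by
  intro μ hμ hμC
  have hpoint : ∀ c, (1 + (ξ c) ^ 2) / 2 * (μstar c) ^ 2 - r c * W c * μstar c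
        + G * (r c * μstar c) ≤
      (1 + (ξ c) ^ 2) / 2 * (μ c) ^ 2 - r c * W c * μ c + G * (r c * μ c) := fun c => by
    rw [hμstar c]
    exact waterfilling_lagrangian_le (by positivity) (hr c).le (W c) G (hμ c)
  have hsum := Finset.sum_le_sum fun c (_ : c ∈ Finset.univ) => hpoint c
  rw [Finset.sum_add_distrib, Finset.sum_add_distrib, ← Finset.mul_sum, ← Finset.mul_sum]
    at hsum
  have hload : ∑ c, r c * μstar c =
      ∑ c, (r c) ^ 2 / (1 + (ξ c) ^ 2) * max (W c - G) 0 :=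
    Finset.sum_congr rfl fun c _ => by rw [hμstar c]; ring
  have hcompl : G * ∑ c, r c * μstar c = G * C := by
    rcases hslack with h | h
    · simp [h]
    · rw [hload, h]
  have hbudget := mul_le_mul_of_nonneg_left hμC hG
  linarith
end

section
/- Let J ≥ 1, let κ : Fin J → ℝ satisfy κ_c > 0 for all c, let W : Fin J → ℝ be nonincreasing with W_c ≥ 0 for all c (i.e., W_1 ≥ W_2 ≥ … ≥ W_J ≥ 0), and let C ≥ 0. For 1 ≤ c ≤ J − 1 define H_c = Σ_{s=1}^{c} κ_s·(W_s − W_{c+1}). Let p be the smallest index c ∈ {1, …, J−1} with H_c > C if such an index exists, and p = J otherwise. Define G = [ ( Σ_{s=1}^{p} κ_s·W_s − C ) / ( Σ_{s=1}^{p} κ_s ) ]⁺. Then G ≥ 0, Σ_{c=1}^{J} κ_c·[W_c − G]⁺ ≤ C, and if G > 0 then Σ_{c=1}^{J} κ_c·[W_c − G]⁺ = C. -/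
/-- Correctness of the explicit waterfilling threshold formula (step 2.1 of
DCNC-Q), stated with 0-based indexing: commodities `0,…,J−1` have
nonincreasing nonnegative weights `W`, positive per-commodity weights `κ`,
capacity `C ≥ 0`; `H c = ∑_{s=0}^{c} κ_s (W_s − W_{c+1})` for
`c ∈ {0,…,J−2}`; `p` is the smallest such `c` with `H c > C` if one exists
and `p = J − 1` otherwise; then
`G = [(∑_{s=0}^{p} κ_s W_s − C)/(∑_{s=0}^{p} κ_s)]⁺` is a valid
waterfilling level. -/
theorem dcnc_q_waterfilling_formula (J : ℕ) (hJ : 1 ≤ J)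
    (κ W : ℕ → ℝ)
    (hκ : ∀ c < J, 0 < κ c) (hWnonneg : ∀ c < J, 0 ≤ W c)
    (hWmono : ∀ c c', c ≤ c' → c' < J → W c' ≤ W c)
    (C : ℝ) (hC : 0 ≤ C)
    (H : ℕ → ℝ)
    (hH : ∀ c, H c = ∑ s ∈ Finset.range (c + 1), κ s * (W s - W (c + 1)))
    (p : ℕ)
    (hp : (p < J - 1 ∧ C < H p ∧ ∀ c < p, H c ≤ C) ∨
          (p = J - 1 ∧ ∀ c < J - 1, H c ≤ C))
    (G : ℝ)
    (hG : G = max ((∑ s ∈ Finset.range (p + 1), κ s * W s - C) /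
            (∑ s ∈ Finset.range (p + 1), κ s)) 0) :
    0 ≤ G ∧ (∑ c ∈ Finset.range J, κ c * max (W c - G) 0 ≤ C) ∧
      (0 < G → ∑ c ∈ Finset.range J, κ c * max (W c - G) 0 = C) := by
  have hpJ : p < J := by omega
  set A := ∑ s ∈ Finset.range (p + 1), κ s * W s with hA
  set K := ∑ s ∈ Finset.range (p + 1), κ s with hK
  have hKpos : 0 < K :=
    Finset.sum_pos (fun s hs => hκ s (by rw [Finset.mem_range] at hs; omega)) ⟨0, by simp⟩
  have hshift (x : ℝ) : ∑ s ∈ Finset.range (p + 1), κ s * (W s - x) = A - K * x := by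
    simp only [mul_sub, Finset.sum_sub_distrib, hA, hK, Finset.sum_mul]
  have hG0 : 0 ≤ G := hG ▸ le_max_right _ _
  have hbelow : ∑ s ∈ Finset.range p, κ s * (W s - W p) ≤ C := by
    rcases p with _ | q
    · simpa using hC
    · rw [← hH q]
      rcases hp with ⟨-, -, h⟩ | ⟨h, h'⟩
      · exact h q (by omega)
      · exact h' q (by omega)
  have hGle : G ≤ W p := by
    rw [hG]
    refine max_le ?_ (hWnonneg p hpJ)
    have h := hshift (W p)
    rw [Finset.sum_range_succ, sub_self, mul_zero, add_zero] at h
    rw [div_le_iff₀ hKpos]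
    linarith
  have hGge : ∀ c, p < c → c < J → W c ≤ G := by
    intro c hpc hcJ
    rcases hp with ⟨-, h, -⟩ | ⟨h, -⟩
    · rw [hH p, hshift] at h
      refine (hWmono (p + 1) c hpc hcJ).trans ?_
      rw [hG]
      refine le_max_of_le_left ?_
      rw [le_div_iff₀ hKpos]
      linarith
    · omega
  have hsum : ∑ c ∈ Finset.range J, κ c * max (W c - G) 0 = A - K * G := by
    rw [← hshift G, ← Finset.sum_subset (Finset.range_mono (Nat.succ_le_of_lt hpJ))]
    · refine Finset.sum_congr rfl fun s hs => ?_
      rw [Finset.mem_range] at hs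
      have := hWmono s p (by omega) hpJ
      rw [max_eq_left (by linarith)]
    · intro c hc hc'
      rw [Finset.mem_range] at hc hc'
      rw [max_eq_right (sub_nonpos.2 (hGge c (by omega) hc)), mul_zero]
  rw [hsum]
  refine ⟨hG0, ?_, fun hpos => ?_⟩
  · have h : (A - C) / K ≤ G := hG ▸ le_max_left _ _
    rw [div_le_iff₀ hKpos] at h
    linarith
  · have h : G = (A - C) / K := by
      rcases max_choice ((A - C) / K) 0 with h | h
      · exact hG.trans h
      · exact absurd (hG.trans h) hpos.ne'
    rw [eq_div_iff hKpos.ne'] at h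
    linarith
end

section
/- Let n ≥ 1 and let Q : ℕ → ℝⁿ satisfy Q_i(t) ≥ 0 for every component i and every t, and define Δf(t) = Q(t+1) − Q(t) componentwise. Let ‖·‖ denote the Euclidean norm on ℝⁿ, and suppose there exist constants B ≥ 0, V > 0, and ρ ≥ 0 such that for all integers t ≥ 1: (‖Q(t)‖² − ‖Q(0)‖²)/2 ≤ B·t + V·ρ·(‖Q(t)‖ + ‖Q(0)‖). Then for every integer t ≥ 1 and every component i: (1/t)·Σ_{τ=0}^{t−1} Δf_i(τ) ≤ (1/t)·( V·ρ + √((V·ρ + ‖Q(0)‖)² + 2·B·t) ). Consequently, for any ε > 0, if V = 1/ε and t ≥ 1/ε², then (1/t)·Σ_{τ=0}^{t−1} Δf_i(τ) ≤ (√(2B) + 2ρ)·ε + 2‖Q(0)‖·ε². -/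
/-- A quadratic drift inequality `(q² - r²) / 2 ≤ c + a (q + r)` bounds `q` by the larger root. -/
theorem le_add_sqrt_of_drift {q r a c : ℝ} (h : (q ^ 2 - r ^ 2) / 2 ≤ c + a * (q + r)) :
    q ≤ a + Real.sqrt ((a + r) ^ 2 + 2 * c) := by
  have : q - a ≤ Real.sqrt ((a + r) ^ 2 + 2 * c) := Real.le_sqrt_of_sq_le (by linarith)
  linarith

/-- `√(x² + y) ≤ x + √y` for nonnegative `x` and `y`. -/
theorem sqrt_sq_add_le {x y : ℝ} (hx : 0 ≤ x) (hy : 0 ≤ y) :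
    Real.sqrt (x ^ 2 + y) ≤ x + Real.sqrt y := by
  rw [Real.sqrt_le_left (by positivity)]
  nlinarith [Real.sq_sqrt hy, mul_nonneg hx (Real.sqrt_nonneg y)]

/-- Deterministic core of the flow-conservation convergence-time bound:
queue backlogs `Q(t)` evolve as `Q(t+1) = Q(t) + Δf(t)`; the summed
Lyapunov drift-plus-penalty bound combined with the Farkas multiplier
inequality yields, for each queue `i`, a bound on the time-average net flow
imbalance, and hence `O(1/ε²)` convergence time to `O(ε)` violation of flow
conservation. -/
theorem flow_conservation_convergence (n : ℕ) (hn : 1 ≤ n)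
    (Q : ℕ → EuclideanSpace ℝ (Fin n)) (hQ : ∀ t i, 0 ≤ Q t i)
    (Δf : ℕ → Fin n → ℝ) (hΔf : ∀ t i, Δf t i = Q (t + 1) i - Q t i)
    (B V ρ : ℝ) (hB : 0 ≤ B) (hV : 0 < V) (hρ : 0 ≤ ρ)
    (hdrift : ∀ t : ℕ, 1 ≤ t →
      (‖Q t‖ ^ 2 - ‖Q 0‖ ^ 2) / 2 ≤ B * (t : ℝ) + V * ρ * (‖Q t‖ + ‖Q 0‖)) :
    (∀ t : ℕ, 1 ≤ t → ∀ i,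
      (1 / (t : ℝ)) * ∑ τ ∈ Finset.range t, Δf τ i ≤
        (1 / (t : ℝ)) * (V * ρ + Real.sqrt ((V * ρ + ‖Q 0‖) ^ 2 + 2 * B * (t : ℝ)))) ∧
    (∀ ε : ℝ, 0 < ε → V = 1 / ε → ∀ t : ℕ, 1 / ε ^ 2 ≤ (t : ℝ) → ∀ i,
      (1 / (t : ℝ)) * ∑ τ ∈ Finset.range t, Δf τ i ≤
        (Real.sqrt (2 * B) + 2 * ρ) * ε + 2 * ‖Q 0‖ * ε ^ 2) := by
  have hbound : ∀ t : ℕ, 1 ≤ t → ∀ i, ∑ τ ∈ Finset.range t, Δf τ i ≤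
      V * ρ + Real.sqrt ((V * ρ + ‖Q 0‖) ^ 2 + 2 * B * (t : ℝ)) := by
    intro t ht i
    have hsum : ∑ τ ∈ Finset.range t, Δf τ i = Q t i - Q 0 i := by
      simp only [hΔf]
      exact Finset.sum_range_sub (fun τ => Q τ i) t
    have hcoord : Q t i ≤ ‖Q t‖ := (le_abs_self _).trans (PiLp.norm_apply_le (Q t) i)
    have hroot := le_add_sqrt_of_drift (hdrift t ht)
    rw [← mul_assoc] at hroot
    linarith [hQ 0 i]
  refine ⟨fun t ht i => mul_le_mul_of_nonneg_left (hbound t ht i) (by positivity), ?_⟩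
  intro ε hε hVε t ht i
  have htpos : (0 : ℝ) < t := lt_of_lt_of_le (by positivity) ht
  have ht2 : 1 ≤ (t : ℝ) * ε ^ 2 := (div_le_iff₀ (by positivity)).mp ht
  have hs : 1 ≤ Real.sqrt t * ε := by
    have := Real.one_le_sqrt.mpr ht2
    rwa [Real.sqrt_mul htpos.le, Real.sqrt_sq hε.le] at this
  have hsqrt := sqrt_sq_add_le (x := V * ρ + ‖Q 0‖) (y := 2 * B * t) (by positivity) (by positivity)
  rw [Real.sqrt_mul (by positivity)] at hsqrt
  have hVt : V ≤ t * ε := by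
    rw [hVε, div_le_iff₀ hε]
    linarith
  have hVρ : V * ρ ≤ t * ε * ρ := mul_le_mul_of_nonneg_right hVt hρ
  have hQ0 : ‖Q 0‖ ≤ ‖Q 0‖ * (t * ε ^ 2) := le_mul_of_one_le_right (norm_nonneg _) ht2
  have hB' : Real.sqrt (2 * B) * Real.sqrt t ≤ Real.sqrt (2 * B) * (t * ε) := by
    refine mul_le_mul_of_nonneg_left ?_ (Real.sqrt_nonneg _)
    calc Real.sqrt t ≤ Real.sqrt t * (Real.sqrt t * ε) :=
          le_mul_of_one_le_right (Real.sqrt_nonneg _) hs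
      _ = t * ε := by rw [← mul_assoc, Real.mul_self_sqrt htpos.le]
  rw [one_div_mul_eq_div, div_le_iff₀ htpos]
  linarith [hbound t (by exact_mod_cast htpos) i, norm_nonneg (Q 0)]
end
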